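/- For every universal self-delimiting Turing machine U and every universal Turing machine T, the halting probability Ω_U is asymptotically random: for every binary digit sequence x with Ω_U = ∑_{i≥0} (x i)·2^{-(i+1)} and every computable real s > 1, there exists a constant c ≥ 0 such that K_T(x_0 ⋯ x_{m−1}) ≥ m/s − c for all m ≥ 1. -/

import Mathlib

open scoped ENNReal

/-- The domain of a Turing machine (a partial function on binary strings). -/
def dom (f : List Bool →. List Bool) : Set (List Bool) := {p | (f p).Dom}

/-- A machine is self-delimiting if its domain is prefix-free. -/
def SelfDelim (f : List Bool →. List Bool) : Prop :=
  ∀ p ∈ dom f, ∀ q ∈ dom f, p <+: q → p = q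

/-- Chaitin's Omega number of a machine, in `[0,∞]`. -/
noncomputable def Omega (f : List Bool →. List Bool) : ℝ≥0∞ :=
  ∑' p : dom f, (2 : ℝ≥0∞)⁻¹ ^ (p : List Bool).length

/-- `bin n` is the binary expansion of `n` with the leading 1 removed. -/
def bin (n : ℕ) : List Bool := (Nat.bits n).reverse.tail

/-- `Υ[A]`: the set of positive integers whose `bin`-code lies in `A`. -/
def Ups (A : Set (List Bool)) : Set ℕ := {n | 1 ≤ n ∧ bin n ∈ A}

/-- The zeta number of a machine, in `[0,∞]`. -/
noncomputable def zeta (f : List Bool →. List Bool) : ℝ≥0∞ :=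
  ∑' n : Ups (dom f), ((n : ℕ) : ℝ≥0∞)⁻¹

/-- `U` is a universal self-delimiting Turing machine. -/
def UnivSD (U : List Bool →. List Bool) : Prop :=
  SelfDelim U ∧ ∀ C : List Bool →. List Bool, Partrec C → SelfDelim C →
    ∃ c : ℕ, ∀ x ∈ dom C, ∃ p : List Bool, p.length ≤ x.length + c ∧ U p = C x

/-- `T` is a universal (plain) Turing machine. -/
def UnivTM (T : List Bool →. List Bool) : Prop :=
  ∀ C : List Bool →. List Bool, Partrec C →
    ∃ c : ℕ, ∀ x ∈ dom C, ∃ p : List Bool, p.length ≤ x.length + c ∧ T p = C x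

/-- Program-size / plain complexity of a string w.r.t. a machine. -/
noncomputable def Cpx (f : List Bool →. List Bool) (y : List Bool) : ℕ :=
  sInf {n : ℕ | ∃ w : List Bool, w.length = n ∧ y ∈ f w}

/-- Natural complexity of a string w.r.t. a machine, with `min ∅ = ∞`. -/
noncomputable def nabla (f : List Bool →. List Bool) (y : List Bool) : ℝ≥0∞ :=
  sInf {c : ℝ≥0∞ | ∃ n : ℕ, 1 ≤ n ∧ y ∈ f (bin n) ∧ c = (n : ℝ≥0∞)}

/-- The real number with binary digit sequence `x`. -/
noncomputable def realDigits (x : ℕ → Bool) : ℝ :=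
  ∑' i : ℕ, (if x i then (1 : ℝ) else 0) * (2 : ℝ)⁻¹ ^ (i + 1)

/-- The extended nonnegative real with binary digit sequence `x`. -/
noncomputable def ennDigits (x : ℕ → Bool) : ℝ≥0∞ :=
  ∑' i : ℕ, (if x i then (1 : ℝ≥0∞) else 0) * (2 : ℝ≥0∞)⁻¹ ^ (i + 1)

/-- The string of the first `m` digits of the sequence `x`. -/
def prefixStr (x : ℕ → Bool) (m : ℕ) : List Bool := (List.range m).map x

/-- A real is computable if it is approximated to within `2⁻ⁿ` by a computable
sequence of rationals. -/
def ComputableReal (s : ℝ) : Prop :=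
  ∃ f : ℕ → ℚ, Computable f ∧ ∀ n : ℕ, |s - (f n : ℝ)| ≤ (2 : ℝ)⁻¹ ^ n

open Encodable

open Nat.Partrec (Code)

theorem primrec_sum_range {α : Type*} [Primcodable α] {h : α → ℕ → ℕ} (hh : Primrec₂ h) :
    Primrec₂ fun a n => ∑ i ∈ Finset.range n, h a i := by
  have key : Primrec₂ fun (a : α) (q : ℕ × ℕ) => q.2 + h a q.1 :=
    Primrec.nat_add.comp (Primrec.snd.comp Primrec.snd)
      (hh.comp Primrec.fst (Primrec.fst.comp Primrec.snd))
  refine (Primrec.nat_rec (Primrec.const 0) key).of_eq fun a n => ?_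
  induction n with
  | zero => rfl
  | succ n ih => rw [Finset.sum_range_succ, ← ih]

/-- The code `c` computes the partial function on natural numbers induced by `U`. -/
def Codes (c : Code) (U : List Bool →. List Bool) : Prop :=
  ∀ n v, v ∈ c.eval n ↔ ∃ p, ∃ z ∈ U p, encode p = n ∧ encode z = v

theorem exists_codes {U : List Bool →. List Bool} (hU : Partrec U) : ∃ c, Codes c U := by
  obtain ⟨c, hc⟩ := Code.exists_code.1 (Partrec.bind_decode₂_iff.1 hU)
  refine ⟨c, fun n v => ?_⟩
  simp only [hc, Part.mem_bind_iff, Part.mem_coe, Part.mem_map_iff, Option.mem_def,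
    decode₂_eq_some]
  constructor
  · rintro ⟨p, hp, z, hz, hv⟩
    exact ⟨p, z, hz, hp, hv⟩
  · rintro ⟨p, z, hz, hp, hv⟩
    exact ⟨p, hp, z, hz, hv⟩

/-- The total weight, scaled by `2 ^ k`, of the programs seen to halt within `k` steps. -/
def stageSum (c : Code) (k : ℕ) : ℕ :=
  ∑ n ∈ Finset.range k, if (c.evaln k n).isSome then
    2 ^ (k - ((decode n : Option (List Bool)).getD []).length) else 0

/-- An upper bound for the codes of the outputs of programs seen to halt within `k` steps. -/
def stageBound (c : Code) (k : ℕ) : ℕ :=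
  ∑ n ∈ Finset.range k, (c.evaln k n).getD 0

theorem primrec_pow_two : Primrec fun n : ℕ => 2 ^ n := by
  refine (Primrec.nat_rec₁ (f := fun _ a => a * 2) 1
    (Primrec.nat_mul.comp Primrec.snd (Primrec.const 2)).to₂).of_eq fun n => ?_
  induction n with
  | zero => rfl
  | succ n ih => rw [pow_succ, ← ih]

theorem primrec_evaln_code (c : Code) : Primrec₂ fun k n : ℕ => c.evaln k n :=
  Code.primrec_evaln.comp
    ((Primrec.fst.pair (Primrec.const c)).pair Primrec.snd)

theorem primrec_stageBound (c : Code) : Primrec (stageBound c) :=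
  (primrec_sum_range (Primrec.option_getD.comp (primrec_evaln_code c) (Primrec.const 0)).to₂).comp
    Primrec.id Primrec.id

theorem primrec_stageSum (c : Code) : Primrec (stageSum c) := by
  have hlen : Primrec₂ fun k n : ℕ =>
      2 ^ (k - ((decode n : Option (List Bool)).getD []).length) :=
    primrec_pow_two.comp (Primrec.nat_sub.comp Primrec.fst (Primrec.list_length.comp
      (Primrec.option_getD.comp (Primrec.decode.comp Primrec.snd) (Primrec.const []))))
  have h : Primrec₂ fun k n : ℕ => bif (c.evaln k n).isSome then
      2 ^ (k - ((decode n : Option (List Bool)).getD []).length) else 0 :=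
    Primrec.cond (Primrec.option_isSome.comp (primrec_evaln_code c)) hlen (Primrec.const 0)
  refine ((primrec_sum_range h).comp Primrec.id Primrec.id).of_eq fun k => ?_
  simp [stageSum, Bool.cond_eq_ite]

/-- The weight of the program `p` if it is seen to halt within `k` steps, and `0` otherwise. -/
noncomputable def haltWeight (c : Code) (k : ℕ) (p : List Bool) : ℝ≥0∞ :=
  if (c.evaln k (encode p)).isSome then 2⁻¹ ^ p.length else 0

theorem two_pow_mul_inv_pow {a k : ℕ} (h : a ≤ k) : (2 : ℝ≥0∞) ^ k * 2⁻¹ ^ a = 2 ^ (k - a) := by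
  obtain ⟨b, rfl⟩ := Nat.exists_eq_add_of_le h
  rw [Nat.add_sub_cancel_left, pow_add, mul_right_comm, ← mul_pow,
    ENNReal.mul_inv_cancel two_ne_zero ENNReal.ofNat_ne_top, one_pow, one_mul]

theorem stageSum_eq {c : Code} {U : List Bool →. List Bool} (hc : Codes c U) (k : ℕ) :
    (stageSum c k : ℝ≥0∞) = 2 ^ k * ∑' p, haltWeight c k p := by
  set G : ℕ → ℝ≥0∞ := fun n => if (c.evaln k n).isSome then
    2 ^ (k - ((decode n : Option (List Bool)).getD []).length) else 0 with hG
  have hlt : ∀ n, (c.evaln k n).isSome → n < k := fun n h => by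
    obtain ⟨v, hv⟩ := Option.isSome_iff_exists.1 h
    exact Code.evaln_bound hv
  have h1 : (stageSum c k : ℝ≥0∞) = ∑' n, G n := by
    rw [tsum_eq_sum (s := Finset.range k)]
    · simp [stageSum, hG]
    · intro n hn
      rw [Finset.mem_range] at hn
      exact if_neg fun h => hn (hlt n h)
  have h2 : Function.support G ⊆ Set.range (encode : List Bool → ℕ) := by
    intro n hn
    have : (c.evaln k n).isSome := by
      by_contra h
      exact hn (if_neg h)
    obtain ⟨v, hv⟩ := Option.isSome_iff_exists.1 this
    obtain ⟨p, _, _, hp, _⟩ := (hc n v).1 (Code.evaln_sound hv)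
    exact ⟨p, hp⟩
  rw [h1, ← encode_injective.tsum_eq h2, ← ENNReal.tsum_mul_left]
  refine tsum_congr fun p => ?_
  simp only [hG, haltWeight, encodek, Option.getD_some]
  split_ifs with h
  · rw [two_pow_mul_inv_pow ((length_le_encode p).trans (hlt _ h).le)]
  · simp

theorem haltWeight_mono (c : Code) (p : List Bool) : Monotone fun k => haltWeight c k p := by
  intro k l hkl
  simp only [haltWeight]
  split_ifs with h₁ h₂
  · exact le_rfl
  · obtain ⟨v, hv⟩ := Option.isSome_iff_exists.1 h₁
    exact absurd (Option.isSome_iff_exists.2 ⟨v, Code.evaln_mono hkl hv⟩) h₂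
  · exact zero_le
  · exact le_rfl

theorem haltWeight_le {c : Code} {U : List Bool →. List Bool} (hc : Codes c U) (k : ℕ)
    (p : List Bool) :
    haltWeight c k p ≤ (dom U).indicator (fun p => 2⁻¹ ^ p.length) p := by
  rw [haltWeight]
  split_ifs with h
  · obtain ⟨v, hv⟩ := Option.isSome_iff_exists.1 h
    obtain ⟨q, z, hz, hq, _⟩ := (hc _ v).1 (Code.evaln_sound hv)
    obtain rfl := encode_injective hq
    rw [Set.indicator_of_mem (show q ∈ dom U from Part.dom_iff_mem.2 ⟨z, hz⟩)]
  · exact zero_le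

theorem iSup_haltWeight {c : Code} {U : List Bool →. List Bool} (hc : Codes c U) (p : List Bool) :
    ⨆ k, haltWeight c k p = (dom U).indicator (fun p => 2⁻¹ ^ p.length) p := by
  refine le_antisymm (iSup_le fun k => haltWeight_le hc k p) ?_
  by_cases hp : p ∈ dom U
  · obtain ⟨z, hz⟩ := Part.dom_iff_mem.1 hp
    obtain ⟨k, hk⟩ := Code.evaln_complete.1 ((hc _ _).2 ⟨p, z, hz, rfl, rfl⟩)
    refine le_iSup_of_le k ?_
    rw [Set.indicator_of_mem hp, haltWeight, if_pos (Option.isSome_iff_exists.2 ⟨_, hk⟩)]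
  · simp [hp]

theorem Omega_eq_tsum_indicator (U : List Bool →. List Bool) :
    Omega U = ∑' p, (dom U).indicator (fun p => 2⁻¹ ^ p.length) p :=
  tsum_subtype (dom U) fun p : List Bool => (2 : ℝ≥0∞)⁻¹ ^ p.length

theorem Omega_eq_iSup {c : Code} {U : List Bool →. List Bool} (hc : Codes c U) :
    Omega U = ⨆ k, ∑' p, haltWeight c k p := by
  simp_rw [Omega_eq_tsum_indicator, ENNReal.tsum_eq_iSup_sum, ← iSup_haltWeight hc]
  rw [iSup_comm]
  exact iSup_congr fun s =>
    ENNReal.finsetSum_iSup_of_monotone fun p => haltWeight_mono c p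

/-- A halting program not yet seen to halt at stage `k` contributes to the remaining weight. -/
theorem tsum_haltWeight_add_le {c : Code} {U : List Bool →. List Bool} (hc : Codes c U) {k : ℕ}
    {p : List Bool} (hp : p ∈ dom U) (hk : ¬ (c.evaln k (encode p)).isSome) :
    (∑' q, haltWeight c k q) + 2⁻¹ ^ p.length ≤ Omega U := by
  classical
  rw [Omega_eq_tsum_indicator, ← tsum_pi_single p ((2 : ℝ≥0∞)⁻¹ ^ p.length), ← ENNReal.tsum_add]
  refine ENNReal.tsum_le_tsum fun q => ?_
  by_cases hq : q = p
  · subst hq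
    simp [haltWeight, hk, hp]
  · simpa [hq] using haltWeight_le hc k q

/-- The natural number with binary digits `y`, most significant digit first. -/
def binVal (y : List Bool) : ℕ := y.foldl (fun n b => 2 * n + b.toNat) 0

theorem primrec_binVal : Primrec binVal := by
  have h : Primrec₂ fun (_ : List Bool) (q : ℕ × Bool) => 2 * q.1 + q.2.toNat :=
    Primrec.nat_add.comp
      (Primrec.nat_mul.comp (Primrec.const 2) (Primrec.fst.comp Primrec.snd))
      ((Primrec.dom_bool Bool.toNat).comp (Primrec.snd.comp Primrec.snd))
  exact Primrec.list_foldl Primrec.id (Primrec.const 0) h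

theorem length_prefixStr (x : ℕ → Bool) (m : ℕ) : (prefixStr x m).length = m := by
  simp [prefixStr]

theorem binVal_prefixStr_succ (x : ℕ → Bool) (m : ℕ) :
    binVal (prefixStr x (m + 1)) = 2 * binVal (prefixStr x m) + (x m).toNat := by
  simp [binVal, prefixStr, List.range_succ]

theorem sum_digits_eq (x : ℕ → Bool) (m : ℕ) :
    ∑ i ∈ Finset.range m, (if x i then (1 : ℝ≥0∞) else 0) * 2⁻¹ ^ (i + 1) =
      binVal (prefixStr x m) * 2⁻¹ ^ m := by
  induction m with
  | zero => simp [binVal, prefixStr]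
  | succ m ih =>
    rw [Finset.sum_range_succ, ih, binVal_prefixStr_succ]
    push_cast
    rw [add_mul, pow_succ, mul_comm (2 : ℝ≥0∞), mul_assoc, mul_left_comm 2,
      ENNReal.mul_inv_cancel two_ne_zero ENNReal.ofNat_ne_top, mul_one]
    cases x m <;> simp

theorem ennDigits_eq (x : ℕ → Bool) (m : ℕ) :
    ennDigits x = binVal (prefixStr x m) * 2⁻¹ ^ m +
      ∑' i, (if x (i + m) then (1 : ℝ≥0∞) else 0) * 2⁻¹ ^ (i + m + 1) := by
  rw [← sum_digits_eq, ennDigits]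
  exact (ENNReal.summable.sum_add_tsum_nat_add' (k := m)).symm

theorem le_ennDigits (x : ℕ → Bool) (m : ℕ) :
    (binVal (prefixStr x m) : ℝ≥0∞) * 2⁻¹ ^ m ≤ ennDigits x := by
  rw [ennDigits_eq x m]
  exact le_self_add

theorem ennDigits_le (x : ℕ → Bool) (m : ℕ) :
    ennDigits x ≤ binVal (prefixStr x m) * 2⁻¹ ^ m + 2⁻¹ ^ m := by
  rw [ennDigits_eq x m]
  gcongr
  calc ∑' i, (if x (i + m) then (1 : ℝ≥0∞) else 0) * 2⁻¹ ^ (i + m + 1)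
      ≤ ∑' i, 2⁻¹ ^ i * 2⁻¹ ^ (m + 1) := by
        refine ENNReal.tsum_le_tsum fun i => ?_
        rw [← pow_add, ← add_assoc]
        split_ifs <;> simp
    _ = 2⁻¹ ^ m := by
        rw [ENNReal.tsum_mul_right, ENNReal.tsum_geometric, ENNReal.one_sub_inv_two, inv_inv,
          pow_succ, mul_left_comm, ENNReal.mul_inv_cancel two_ne_zero ENNReal.ofNat_ne_top,
          mul_one]

/-- By stage `k`, the halting weight exceeds the number with binary digits `y` up to one unit in
the last place. -/
def reached (c : Code) (y : List Bool) (k : ℕ) : Bool :=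
  decide (binVal y * 2 ^ k < stageSum c k * 2 ^ y.length + 2 ^ k)

theorem primrec_reached (c : Code) : Primrec₂ (reached c) := by
  have hp : Primrec fun q : List Bool × ℕ => 2 ^ q.2 := primrec_pow_two.comp Primrec.snd
  have := Primrec.nat_lt.comp
    (Primrec.nat_mul.comp (primrec_binVal.comp Primrec.fst) hp)
    (Primrec.nat_add.comp (Primrec.nat_mul.comp ((primrec_stageSum c).comp Primrec.snd)
      (primrec_pow_two.comp (Primrec.list_length.comp Primrec.fst))) hp)
  exact this.decide

theorem reached_iff {c : Code} {U : List Bool →. List Bool} (hc : Codes c U) (y : List Bool)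
    (k : ℕ) :
    reached c y k = true ↔
      (binVal y : ℝ≥0∞) * 2⁻¹ ^ y.length < (∑' p, haltWeight c k p) + 2⁻¹ ^ y.length := by
  have h0 : (2 : ℝ≥0∞) ^ k * 2 ^ y.length ≠ 0 := by positivity
  have ht : (2 : ℝ≥0∞) ^ k * 2 ^ y.length ≠ ⊤ := by finiteness
  have hinv : (2 : ℝ≥0∞) ^ y.length * 2⁻¹ ^ y.length = 1 := by
    rw [two_pow_mul_inv_pow le_rfl, Nat.sub_self, pow_zero]
  rw [reached, decide_eq_true_iff, ← Nat.cast_lt (α := ℝ≥0∞), ← ENNReal.mul_lt_mul_iff_right (b := _ * 2⁻¹ ^ y.length) h0 ht]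
  push_cast
  rw [stageSum_eq hc]
  have e1 : (2 : ℝ≥0∞) ^ k * 2 ^ y.length * (binVal y * 2⁻¹ ^ y.length) =
      binVal y * 2 ^ k * (2 ^ y.length * 2⁻¹ ^ y.length) := by ring
  have e2 : (2 : ℝ≥0∞) ^ k * 2 ^ y.length * ((∑' p, haltWeight c k p) + 2⁻¹ ^ y.length) =
      2 ^ k * (∑' p, haltWeight c k p) * 2 ^ y.length +
        2 ^ k * (2 ^ y.length * 2⁻¹ ^ y.length) := by ring
  rw [e1, e2, hinv, mul_one, mul_one]

/-- Run the enumeration of halting programs until `reached`, then output a string that no program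
enumerated so far outputs. -/
def freshOutput (c : Code) : List Bool →. List Bool := fun y =>
  (Nat.rfind fun k => Part.some (reached c y k)).map
    fun k => List.replicate (stageBound c k + 1) true

theorem primrec_replicate_true : Primrec fun n : ℕ => List.replicate n true := by
  refine (Primrec.nat_rec₁ (f := fun _ a => true :: a) []
    (Primrec.list_cons.comp (Primrec.const true) Primrec.snd).to₂).of_eq fun n => ?_
  induction n with
  | zero => rfl
  | succ n ih => rw [List.replicate_succ, ← ih]

theorem partrec_freshOutput (c : Code) : Partrec (freshOutput c) := by
  refine Partrec.map (Partrec.rfind (primrec_reached c).to_comp.partrec₂) ?_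
  exact (primrec_replicate_true.comp
    (Primrec.succ.comp ((primrec_stageBound c).comp Primrec.snd))).to_comp

theorem freshOutput_prefixStr {c : Code} {U : List Bool →. List Bool} (hc : Codes c U)
    {x : ℕ → Bool} (hx : Omega U = ennDigits x) (m : ℕ) :
    ∃ z ∈ freshOutput c (prefixStr x m), ∀ p, z ∈ U p → m ≤ p.length := by
  set y := prefixStr x m with hy
  have hm : y.length = m := length_prefixStr x m
  have hlo : (binVal y : ℝ≥0∞) * 2⁻¹ ^ m ≤ Omega U := hx ▸ le_ennDigits x m
  have hhi : Omega U ≤ binVal y * 2⁻¹ ^ m + 2⁻¹ ^ m := hx ▸ ennDigits_le x m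
  have hpos : (2 : ℝ≥0∞)⁻¹ ^ m ≠ 0 := by simp
  have hfin : Omega U ≠ ⊤ := ne_top_of_le_ne_top (by finiteness) hhi
  have hex : ∃ k, reached c y k = true := by
    simp_rw [reached_iff hc, hm]
    rw [← lt_iSup_iff, ← ENNReal.iSup_add, ← Omega_eq_iSup hc]
    exact hlo.trans_lt (ENNReal.lt_add_right hfin hpos)
  obtain ⟨k₀, hk₀⟩ := hex
  obtain ⟨k, hk, -⟩ := Nat.rfind_min' hk₀
  have hkr : reached c y k = true := (Part.mem_some_iff.1 (Nat.rfind_spec hk)).symm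
  refine ⟨_, Part.mem_map _ hk, fun p hp => ?_⟩
  by_contra! hlt
  have hpd : p ∈ dom U := Part.dom_iff_mem.2 ⟨_, hp⟩
  by_cases hseen : (c.evaln k (encode p)).isSome
  · obtain ⟨v, hv⟩ := Option.isSome_iff_exists.1 hseen
    have hve : v = encode (List.replicate (stageBound c k + 1) true) :=
      Part.mem_unique (Code.evaln_sound hv) ((hc _ _).2 ⟨p, _, hp, rfl, rfl⟩)
    have h1 : v ≤ stageBound c k := by
      have := Finset.single_le_sum (f := fun n => (c.evaln k n).getD 0)
        (fun _ _ => Nat.zero_le _) (Finset.mem_range.2 (Code.evaln_bound hv))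
      rwa [show c.evaln k (encode p) = some v from hv] at this
    have h2 := length_le_encode (List.replicate (stageBound c k + 1) true)
    rw [← hve, List.length_replicate] at h2
    omega
  · have h1 := tsum_haltWeight_add_le hc hpd hseen
    rw [reached_iff hc, hm] at hkr
    have hσ : (∑' q, haltWeight c k q) ≠ ⊤ := ne_top_of_le_ne_top hfin (le_self_add.trans h1)
    have h2 : (2 : ℝ≥0∞)⁻¹ ^ m + 2⁻¹ ^ m ≤ 2⁻¹ ^ p.length := by
      obtain ⟨d, rfl⟩ := Nat.exists_eq_add_of_lt hlt
      rw [← two_mul, pow_succ, mul_left_comm, ENNReal.mul_inv_cancel two_ne_zero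
        ENNReal.ofNat_ne_top, mul_one]
      exact pow_le_pow_right_of_le_one' (by simp) (by omega)
    have h3 : Omega U < (∑' q, haltWeight c k q) + 2⁻¹ ^ p.length :=
      calc Omega U ≤ binVal y * 2⁻¹ ^ m + 2⁻¹ ^ m := hhi
        _ < (∑' q, haltWeight c k q) + 2⁻¹ ^ m + 2⁻¹ ^ m :=
          ENNReal.add_lt_add_right (by finiteness) hkr
        _ ≤ _ := by rw [add_assoc]; gcongr
    exact h3.not_ge h1

/-- Run `F` on `w` when given the input `1ᵃ0w` with `|w| = N * a + r`. -/
def blockMachine (F : List Bool →. List Bool) (N r : ℕ) : List Bool →. List Bool := fun p =>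
  bif decide (p.length = p.idxOf false + 1 + (N * p.idxOf false + r)) then
    F (p.drop (p.idxOf false + 1)) else Part.none

theorem partrec_blockMachine {F : List Bool →. List Bool} (hF : Partrec F) (N r : ℕ) :
    Partrec (blockMachine F N r) := by
  have hi : Primrec fun p : List Bool => p.idxOf false := Primrec.list_idxOf.comp (Primrec.const false) Primrec.id
  have hs : Primrec fun p : List Bool => p.idxOf false + 1 := Primrec.succ.comp hi
  have hcond : PrimrecPred fun p : List Bool =>
      p.length = p.idxOf false + 1 + (N * p.idxOf false + r) :=
    Primrec.eq.comp Primrec.list_length (Primrec.nat_add.comp hs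
      (Primrec.nat_add.comp (Primrec.nat_mul.comp (Primrec.const N) hi) (Primrec.const r)))
  exact Partrec.cond hcond.decide.to_comp
    (hF.comp (Primrec.list_drop.comp hs Primrec.id).to_comp) Partrec.none

theorem selfDelim_blockMachine (F : List Bool →. List Bool) (N r : ℕ) :
    SelfDelim (blockMachine F N r) := by
  have key : ∀ p ∈ dom (blockMachine F N r),
      p.length = p.idxOf false + 1 + (N * p.idxOf false + r) := by
    intro p hp
    by_contra h
    simp [dom, blockMachine, h] at hp
  rintro p hp q hq ⟨t, rfl⟩
  have h1 := key p hp
  have h2 := key _ hq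
  have hmem : false ∈ p := List.idxOf_lt_length_iff.1 (by omega)
  rw [List.idxOf_append_of_mem hmem, ← h1, List.length_append] at h2
  have : t = [] := List.length_eq_zero_iff.1 (by omega)
  rw [this, List.append_nil]

theorem blockMachine_apply (F : List Bool →. List Bool) {N r a : ℕ} {w : List Bool}
    (hw : w.length = N * a + r) :
    blockMachine F N r (List.replicate a true ++ false :: w) = F w := by
  have hi : (List.replicate a true ++ false :: w).idxOf false = a := by
    rw [List.idxOf_append_of_notMem (by simp [List.mem_replicate])]
    simp
  have hd : (List.replicate a true ++ false :: w).drop (a + 1) = w := by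
    rw [List.drop_append]
    simp
  rw [blockMachine, hi, hd]
  simp [hw, add_assoc, add_comm, add_left_comm]

theorem exists_length_eq_Cpx {T : List Bool →. List Bool} (hT : UnivTM T) (y : List Bool) :
    ∃ w, w.length = Cpx T y ∧ y ∈ T w := by
  obtain ⟨_, hc⟩ := hT (fun p => Part.some p) Partrec.some
  obtain ⟨p, -, hp⟩ := hc y trivial
  exact Nat.sInf_mem (s := {n | ∃ w : List Bool, w.length = n ∧ y ∈ T w})
    ⟨p.length, p, rfl, hp ▸ Part.mem_some y⟩

theorem exists_le_Cpx_add_div {U T : List Bool →. List Bool} (hU : Partrec U) (hUuniv : UnivSD U)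
    (hT : Partrec T) (hTuniv : UnivTM T) {x : ℕ → Bool} (hx : Omega U = ennDigits x) {N : ℕ}
    (hN : 0 < N) :
    ∃ c : ℕ, ∀ m, m ≤ Cpx T (prefixStr x m) + Cpx T (prefixStr x m) / N + c := by
  obtain ⟨code, hc⟩ := exists_codes hU
  set F : List Bool →. List Bool := fun w => (T w).bind (freshOutput code) with hF
  have hFp : Partrec F := hT.bind ((partrec_freshOutput code).comp Computable.snd)
  choose b hb using fun r => hUuniv.2 _ (partrec_blockMachine hFp N r)
    (selfDelim_blockMachine F N r)
  refine ⟨∑ r ∈ Finset.range N, b r + 1, fun m => ?_⟩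
  obtain ⟨w, hw, hTw⟩ := exists_length_eq_Cpx hTuniv (prefixStr x m)
  obtain ⟨z, hz, hzm⟩ := freshOutput_prefixStr hc hx m
  set K := Cpx T (prefixStr x m)
  have hp := blockMachine_apply F (N := N) (r := K % N) (a := K / N) (w := w)
    (hw.trans (Nat.div_add_mod K N).symm)
  have hzF : z ∈ F w := Part.mem_bind hTw hz
  rw [← hp] at hzF
  obtain ⟨q, hql, hq⟩ := hb (K % N) _ (Part.dom_iff_mem.2 ⟨z, hzF⟩)
  have hmq := hzm q (hq ▸ hzF)
  have hle : b (K % N) ≤ ∑ r ∈ Finset.range N, b r :=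
    Finset.single_le_sum (fun _ _ => Nat.zero_le _) (Finset.mem_range.2 (Nat.mod_lt K hN))
  simp only [List.length_append, List.length_replicate, List.length_cons, hw] at hql
  omega

/-- The halting probability `Ω_U` of a universal self-delimiting Turing machine
is asymptotically random. -/
theorem stmt_15 (U : List Bool →. List Bool) (hU : Partrec U) (hUuniv : UnivSD U)
    (T : List Bool →. List Bool) (hT : Partrec T) (hTuniv : UnivTM T)
    (x : ℕ → Bool) (hx : Omega U = ennDigits x) :
    ∀ s : ℝ, ComputableReal s → 1 < s →
      ∃ c : ℝ, 0 ≤ c ∧ ∀ m : ℕ, 1 ≤ m →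
        (Cpx T (prefixStr x m) : ℝ) ≥ m / s - c := by
  intro s _ hs
  obtain ⟨n, hn⟩ := exists_nat_one_div_lt (sub_pos.2 hs)
  obtain ⟨c, hc⟩ := exists_le_Cpx_add_div hU hUuniv hT hTuniv hx n.succ_pos
  refine ⟨c, c.cast_nonneg, fun m _ => ?_⟩
  have hs0 : 0 < s := by linarith
  have hm : (m : ℝ) ≤ Cpx T (prefixStr x m) + ((Cpx T (prefixStr x m) / (n + 1) : ℕ) : ℝ) + c := by
    exact_mod_cast hc m
  set K : ℕ := Cpx T (prefixStr x m)
  have hdiv : ((K / (n + 1) : ℕ) : ℝ) ≤ K * (s - 1) :=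
    calc ((K / (n + 1) : ℕ) : ℝ) ≤ K / ((n + 1 : ℕ) : ℝ) := Nat.cast_div_le
      _ = K * (1 / ((n : ℝ) + 1)) := by push_cast; ring
      _ ≤ K * (s - 1) := by gcongr
  have hcs : (c : ℝ) ≤ c * s := le_mul_of_one_le_right c.cast_nonneg hs.le
  rw [ge_iff_le, sub_le_iff_le_add, div_le_iff₀ hs0]
  linarith
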